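/- arXiv:2002.04166 — 4 statements merged into one kernel-verified Lean document; each statement's English description precedes it below -/
import Mathlib

section
/- Let P be a positive integer, let A₁, A₂ be Hermitian P×P complex matrices, let b₁, b₂ ∈ ℂ^P, and let c₁, c₂ ∈ ℝ. For i = 1, 2 define F_i(x) = x^H A_i x + 2·Re(b_i^H x) + c_i for x ∈ ℂ^P (the value x^H A_i x is real because A_i is Hermitian). Assume the Slater condition: there exists x̄ ∈ ℂ^P with F₁(x̄) < 0. Then the implication 'for all x ∈ ℂ^P, F₁(x) ≤ 0 implies F₂(x) ≤ 0' holds if and only if there exists a real κ ≥ 0 such that the (P+1)×(P+1) Hermitian block matrix κ·[[A₁, b₁],[b₁^H, c₁]] − [[A₂, b₂],[b₂^H, c₂]] is positive semidefinite. -/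
open Matrix
open scoped ComplexOrder

/-- The quadratic function `F(x) = xᴴ A x + 2 Re(bᴴ x) + c`. -/
noncomputable def quadForm {P : ℕ} (A : Matrix (Fin P) (Fin P) ℂ) (b : Fin P → ℂ) (c : ℝ)
    (x : Fin P → ℂ) : ℝ :=
  (star x ⬝ᵥ A.mulVec x).re + 2 * (star b ⬝ᵥ x).re + c

/-- The `(P+1) × (P+1)` Hermitian block matrix `[[A, b], [bᴴ, c]]`. -/
noncomputable def blockMat {P : ℕ} (A : Matrix (Fin P) (Fin P) ℂ) (b : Fin P → ℂ) (c : ℝ) :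
    Matrix (Fin P ⊕ Fin 1) (Fin P ⊕ Fin 1) ℂ :=
  Matrix.fromBlocks A (Matrix.of fun i _ => b i) (Matrix.of fun _ j => star (b j))
    (Matrix.of fun _ _ => (c : ℂ))

/-- The real quadratic form `y ↦ Re (yᴴ M y)` of a complex matrix. -/
noncomputable def reForm {n : Type*} [Fintype n] (M : Matrix n n ℂ) (y : n → ℂ) : ℝ :=
  (star y ⬝ᵥ M *ᵥ y).re

section reForm

variable {n : Type*} [Fintype n]

lemma reForm_add_smul {M : Matrix n n ℂ} (hM : M.IsHermitian) (x y : n → ℂ) (a : ℂ) :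
    reForm M (x + a • y) =
      reForm M x + Complex.normSq a * reForm M y + 2 * (a * (star x ⬝ᵥ M *ᵥ y)).re := by
  have hswap : star y ⬝ᵥ M *ᵥ x = star (star x ⬝ᵥ M *ᵥ y) := by
    rw [star_dotProduct, star_mulVec, hM.eq, dotProduct_mulVec]
  simp only [reForm, star_add, star_smul, mulVec_add, mulVec_smul, add_dotProduct, dotProduct_add,
    smul_dotProduct, dotProduct_smul, hswap, smul_eq_mul, Complex.add_re, Complex.mul_re,
    Complex.mul_im, Complex.add_im, Complex.star_def, Complex.conj_re, Complex.conj_im,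
    Complex.normSq_apply]
  ring

lemma reForm_smul (M : Matrix n n ℂ) (y : n → ℂ) (a : ℂ) :
    reForm M (a • y) = Complex.normSq a * reForm M y := by
  simp only [reForm, star_smul, mulVec_smul, smul_dotProduct, dotProduct_smul, smul_eq_mul,
    Complex.mul_re, Complex.mul_im, Complex.star_def, Complex.conj_re, Complex.conj_im,
    Complex.normSq_apply]
  ring

lemma reForm_smul_sub (M N : Matrix n n ℂ) (κ : ℝ) (y : n → ℂ) :
    reForm (κ • M - N) y = κ * reForm M y - reForm N y := by
  simp [reForm, sub_mulVec, smul_mulVec, dotProduct_sub, dotProduct_smul]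

lemma posSemidef_iff_reForm_nonneg {M : Matrix n n ℂ} (hM : M.IsHermitian) :
    M.PosSemidef ↔ ∀ y, 0 ≤ reForm M y := by
  rw [posSemidef_iff_dotProduct_mulVec, and_iff_right hM]
  refine forall_congr' fun y => ?_
  have him : (star y ⬝ᵥ M *ᵥ y).im = 0 := hM.im_star_dotProduct_mulVec_self y
  simp [reForm, Complex.le_def, him]

lemma exists_normSq_eq_one_re_mul_eq_zero (z : ℂ) :
    ∃ w : ℂ, Complex.normSq w = 1 ∧ (w * z).re = 0 := by
  rcases eq_or_ne z 0 with rfl | hz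
  · exact ⟨1, by simp, by simp⟩
  · have hn : (‖z‖ : ℝ) ≠ 0 := norm_ne_zero_iff.mpr hz
    refine ⟨Complex.I * star z / ‖z‖, ?_, ?_⟩
    · simp [Complex.normSq_eq_norm_sq, hn]
    · rw [div_mul_eq_mul_div, Complex.div_ofReal_re]
      simp [Complex.mul_re, Complex.mul_im]
      left; ring

lemma nonpos_of_forall_pos_quadratic_nonpos {a b c : ℝ}
    (h : ∀ ε : ℝ, 0 < ε → a + ε ^ 2 * b + ε * c ≤ 0) : a ≤ 0 := by
  have hcont : Continuous fun ε : ℝ => a + ε ^ 2 * b + ε * c := by fun_prop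
  have hlim := (hcont.tendsto 0).mono_left (nhdsWithin_le_nhds (s := Set.Ioi 0))
  simp only [ne_eq, OfNat.ofNat_ne_zero, not_false_eq_true, zero_pow, zero_mul, add_zero] at hlim
  exact le_of_tendsto hlim (by filter_upwards [self_mem_nhdsWithin] with ε hε using h ε hε)

/-- If `M` is negative at `u`, then nonpositivity of `N` on points where `M` is negative and a
coordinate `j` with `u j ≠ 0` does not vanish extends to all points where `M` is nonpositive. -/
lemma reForm_nonpos_of_coord_ne_zero {M N : Matrix n n ℂ} (hM : M.IsHermitian)
    (hN : N.IsHermitian) {u : n → ℂ} (hu : reForm M u < 0) {j : n} (huj : u j ≠ 0)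
    (h : ∀ y, y j ≠ 0 → reForm M y ≤ 0 → reForm N y ≤ 0) (y : n → ℂ)
    (hy : reForm M y ≤ 0) : reForm N y ≤ 0 := by
  by_cases hyj : y j = 0
  swap
  · exact h y hyj hy
  obtain ⟨w, hw, hwz⟩ := exists_normSq_eq_one_re_mul_eq_zero (star y ⬝ᵥ M *ᵥ u)
  have hw0 : w ≠ 0 := by rintro rfl; simp at hw
  refine nonpos_of_forall_pos_quadratic_nonpos (b := reForm N u)
    (c := 2 * (w * (star y ⬝ᵥ N *ᵥ u)).re) fun ε hε => ?_
  have key := h (y + ((ε : ℂ) * w) • u) (by simp [hyj, hε.ne', hw0, huj]) (by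
    rw [reForm_add_smul hM, mul_assoc, Complex.re_ofReal_mul, hwz, Complex.normSq_mul, hw,
      Complex.normSq_ofReal]
    nlinarith [mul_pos hε hε])
  rw [reForm_add_smul hN, mul_assoc, Complex.re_ofReal_mul, Complex.normSq_mul, hw,
    Complex.normSq_ofReal] at key
  linarith

lemma reForm_mul_le_mul {M N : Matrix n n ℂ} (hM : M.IsHermitian) (hN : N.IsHermitian)
    (h : ∀ y, reForm M y ≤ 0 → reForm N y ≤ 0) {u v : n → ℂ}
    (hu : reForm M u < 0) (hv : 0 < reForm M v) :
    reForm M v * reForm N u ≤ reForm M u * reForm N v := by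
  obtain ⟨w, hw, hwz⟩ := exists_normSq_eq_one_re_mul_eq_zero (star u ⬝ᵥ M *ᵥ v)
  set r : ℝ := √(-reForm M u / reForm M v)
  have hr : r * r * reForm M v = -reForm M u := by
    rw [Real.mul_self_sqrt (div_nonneg (by linarith) hv.le), div_mul_cancel₀ _ hv.ne']
  have bound (s : ℝ) (hs : s * s = r * r) :
      reForm N u + r * r * reForm N v + 2 * (s * (w * (star u ⬝ᵥ N *ᵥ v)).re) ≤ 0 := by
    have key := h (u + ((s : ℂ) * w) • v) (by
      rw [reForm_add_smul hM, mul_assoc, Complex.re_ofReal_mul, hwz, Complex.normSq_mul, hw,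
        Complex.normSq_ofReal]
      linarith [congrArg (· * reForm M v) hs])
    rwa [reForm_add_smul hN, mul_assoc, Complex.re_ofReal_mul, Complex.normSq_mul, hw,
      Complex.normSq_ofReal, mul_one, hs] at key
  have hsum : reForm N u + r * r * reForm N v ≤ 0 := by
    linarith [bound r rfl, bound (-r) (by ring)]
  calc reForm M v * reForm N u
      = reForm M v * (reForm N u + r * r * reForm N v)
          - r * r * reForm M v * reForm N v := by ring
    _ ≤ reForm M u * reForm N v := by
        rw [hr]; linarith [mul_nonpos_of_nonneg_of_nonpos hv.le hsum]

/-- The homogeneous S-procedure for two Hermitian forms. -/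
theorem exists_posSemidef_smul_sub {M N : Matrix n n ℂ} (hM : M.IsHermitian)
    (hN : N.IsHermitian) (hneg : ∃ u, reForm M u < 0)
    (h : ∀ y, reForm M y ≤ 0 → reForm N y ≤ 0) :
    ∃ κ : ℝ, 0 ≤ κ ∧ (κ • M - N).PosSemidef := by
  set S : Set ℝ := (fun u => reForm N u / reForm M u) '' {u | reForm M u < 0}
  have hS0 : ∀ t ∈ S, 0 ≤ t := by
    rintro _ ⟨u, hu, rfl⟩
    exact div_nonneg_of_nonpos (h u (le_of_lt hu)) (le_of_lt hu)
  have hSne : S.Nonempty := Set.Nonempty.image _ hneg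
  have hherm : (sInf S • M - N).IsHermitian :=
    (hM.smul (IsSelfAdjoint.all (sInf S))).sub hN
  refine ⟨sInf S, Real.sInf_nonneg hS0, (posSemidef_iff_reForm_nonneg hherm).2 fun v => ?_⟩
  rw [reForm_smul_sub, sub_nonneg]
  rcases lt_trichotomy (reForm M v) 0 with hv | hv | hv
  · exact (le_div_iff_of_neg hv).1 (csInf_le ⟨0, hS0⟩ ⟨v, hv, rfl⟩)
  · simpa [hv] using h v hv.le
  · rw [← div_le_iff₀ hv]
    refine le_csInf hSne ?_
    rintro _ ⟨u, hu, rfl⟩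
    have hu' : reForm M u < 0 := hu
    rw [le_div_iff_of_neg hu', div_mul_eq_mul_div, le_div_iff₀ hv]
    linarith [reForm_mul_le_mul hM hN h hu' hv]

end reForm

section blockMat

variable {P : ℕ} {A : Matrix (Fin P) (Fin P) ℂ}

lemma blockMat_isHermitian (hA : A.IsHermitian) (b : Fin P → ℂ) (c : ℝ) :
    (blockMat A b c).IsHermitian := by
  refine hA.fromBlocks ?_ ?_
  · ext i j; simp
  · ext i j; simp

lemma reForm_blockMat_one (A : Matrix (Fin P) (Fin P) ℂ) (b : Fin P → ℂ) (c : ℝ)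
    (x : Fin P → ℂ) :
    reForm (blockMat A b c) (Sum.elim x 1) = quadForm A b c x := by
  have hcol : (of fun i (_ : Fin 1) => b i) *ᵥ 1 = b := by
    ext i; simp [mulVec, dotProduct]
  have hrow : (of fun (_ : Fin 1) j => star (b j)) *ᵥ x = fun _ => star b ⬝ᵥ x := rfl
  have hswap : star x ⬝ᵥ b = star (star b ⬝ᵥ x) := by
    rw [star_dotProduct]
  have hstar : star (Sum.elim x (1 : Fin 1 → ℂ)) = Sum.elim (star x) 1 := by
    ext i; cases i <;> simp
  rw [reForm, blockMat, fromBlocks_mulVec, hstar, sumElim_dotProduct_sumElim]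
  simp only [Sum.elim_comp_inl, Sum.elim_comp_inr, hcol, hrow, dotProduct_add, hswap, quadForm]
  simp [dotProduct, mulVec]
  ring

lemma reForm_blockMat (A : Matrix (Fin P) (Fin P) ℂ) (b : Fin P → ℂ) (c : ℝ)
    {y : Fin P ⊕ Fin 1 → ℂ} (hy : y (Sum.inr 0) ≠ 0) :
    reForm (blockMat A b c) y = Complex.normSq (y (Sum.inr 0)) *
      quadForm A b c ((y (Sum.inr 0))⁻¹ • (y ∘ Sum.inl)) := by
  rw [← reForm_blockMat_one, ← reForm_smul]
  congr 1
  ext (i | i)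
  · simp [hy]
  · simp [Subsingleton.elim i 0]

end blockMat

/-- The complex S-Procedure with Slater condition. -/
theorem sProcedure (P : ℕ) (hP : 0 < P)
    (A₁ A₂ : Matrix (Fin P) (Fin P) ℂ) (hA₁ : A₁.IsHermitian) (hA₂ : A₂.IsHermitian)
    (b₁ b₂ : Fin P → ℂ) (c₁ c₂ : ℝ)
    (hSlater : ∃ x₀ : Fin P → ℂ, quadForm A₁ b₁ c₁ x₀ < 0) :
    (∀ x : Fin P → ℂ, quadForm A₁ b₁ c₁ x ≤ 0 → quadForm A₂ b₂ c₂ x ≤ 0) ↔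
      ∃ κ : ℝ, 0 ≤ κ ∧ (κ • blockMat A₁ b₁ c₁ - blockMat A₂ b₂ c₂).PosSemidef := by
  constructor
  · intro h
    obtain ⟨x₀, hx₀⟩ := hSlater
    rw [← reForm_blockMat_one] at hx₀
    have hB₁ := blockMat_isHermitian hA₁ b₁ c₁
    have hB₂ := blockMat_isHermitian hA₂ b₂ c₂
    refine exists_posSemidef_smul_sub hB₁ hB₂ ⟨_, hx₀⟩
      (reForm_nonpos_of_coord_ne_zero hB₁ hB₂ hx₀ (j := Sum.inr 0) (by simp) fun y hy hle => ?_)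
    have hpos := Complex.normSq_pos.2 hy
    rw [reForm_blockMat _ _ _ hy] at hle ⊢
    exact mul_nonpos_of_nonneg_of_nonpos hpos.le (h _ (nonpos_of_mul_nonpos_right hle hpos))
  · rintro ⟨κ, hκ, hpsd⟩ x hx
    have hnn := (posSemidef_iff_reForm_nonneg hpsd.isHermitian).1 hpsd (Sum.elim x 1)
    rw [reForm_smul_sub, reForm_blockMat_one, reForm_blockMat_one] at hnn
    linarith [mul_nonpos_of_nonneg_of_nonpos hκ hx]
end

section
/- Let N, L be positive integers, let V be a positive semidefinite N×N complex matrix with rank(V) = R satisfying R² > L, and let G₁, …, G_L be Hermitian N×N complex matrices. Then there exists a positive semidefinite N×N complex matrix V̂ with rank(V̂) ≤ R − 1 and Tr(G_l V̂) = Tr(G_l V) for every l = 1, …, L. -/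
open Matrix
open scoped ComplexOrder

/-- A positive semidefinite matrix factors as `X * Xᴴ` with `X` having `V.rank` columns. -/
lemma Matrix.PosSemidef.exists_eq_mul_conjTranspose_card_eq_rank {n : Type*} [Fintype n]
    [DecidableEq n] {V : Matrix n n ℂ} (hV : V.PosSemidef) :
    ∃ X : Matrix n (Fin V.rank) ℂ, V = X * Xᴴ := by
  have hcard := hV.1.rank_eq_card_non_zero_eigs
  let e : Fin V.rank ≃ {i // hV.1.eigenvalues i ≠ 0} :=
    (finCongr hcard).trans (Fintype.equivFin _).symm
  let U : Matrix n n ℂ := hV.1.eigenvectorUnitary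
  refine ⟨Matrix.of fun i k => U i (e k) * (√(hV.1.eigenvalues (e k)) : ℝ), ?_⟩
  have hspec : V = U * diagonal (fun i => (hV.1.eigenvalues i : ℂ)) * Uᴴ := by
    conv_lhs => rw [hV.1.spectral_theorem, Unitary.conjStarAlgAut_apply]
    rfl
  ext i j
  conv_lhs => rw [hspec]
  rw [mul_apply, mul_apply]
  simp only [mul_diagonal, conjTranspose_apply, of_apply]
  rw [e.sum_comp (fun k => U i k * (√(hV.1.eigenvalues k) : ℝ) *
    star (U j k * (√(hV.1.eigenvalues k) : ℝ)))]
  rw [← Finset.sum_subtype (Finset.univ.filter fun k => hV.1.eigenvalues k ≠ 0) (by simp)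
    (fun k => U i k * (√(hV.1.eigenvalues k) : ℝ) *
      star (U j k * (√(hV.1.eigenvalues k) : ℝ))), Finset.sum_filter]
  refine Finset.sum_congr rfl fun k _ => ?_
  have hsqrt : ((√(hV.1.eigenvalues k) : ℝ) : ℂ) * (√(hV.1.eigenvalues k) : ℝ) =
      hV.1.eigenvalues k := by
    rw [← Complex.ofReal_mul, Real.mul_self_sqrt (hV.eigenvalues_nonneg k)]
  split_ifs with hk
  · rw [← hsqrt]
    simp only [star_mul', Complex.star_def, Complex.conj_ofReal]
    ring
  · simp [not_not.mp hk]

/-- The real-linear parametrization `A ↦ (A + Aᵀ) + i (A - Aᵀ)` of Hermitian matrices by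
real matrices. -/
noncomputable def hermitianOfReal (n : Type*) : Matrix n n ℝ →ₗ[ℝ] Matrix n n ℂ where
  toFun A := Matrix.of fun i j => ⟨A i j + A j i, A i j - A j i⟩
  map_add' A B := by
    ext i j
    apply Complex.ext <;> simp <;> ring
  map_smul' c A := by
    ext i j
    apply Complex.ext <;> simp <;> ring

lemma isHermitian_hermitianOfReal {n : Type*} (A : Matrix n n ℝ) :
    (hermitianOfReal n A).IsHermitian := by
  ext i j
  apply Complex.ext <;> simp [hermitianOfReal, add_comm]

lemma hermitianOfReal_injective (n : Type*) : Function.Injective (hermitianOfReal n) := by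
  intro A B h
  ext i j
  have hij := congrFun (congrFun h i) j
  have hre := congrArg Complex.re hij
  have him := congrArg Complex.im hij
  simp only [hermitianOfReal, LinearMap.coe_mk, AddHom.coe_mk, of_apply] at hre him
  linarith

lemma Matrix.IsHermitian.im_trace_mul_eq_zero {n : Type*} [Fintype n] {A B : Matrix n n ℂ}
    (hA : A.IsHermitian) (hB : B.IsHermitian) : (A * B).trace.im = 0 := by
  have h : star (A * B).trace = (A * B).trace := by
    rw [← trace_conjTranspose, conjTranspose_mul, hA.eq, hB.eq, trace_mul_comm]
  exact Complex.conj_eq_iff_im.mp h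

/-- Fewer than `(card n)²` Hermitian trace constraints admit a nonzero Hermitian solution. -/
lemma exists_isHermitian_ne_zero_trace_mul_eq_zero {n ι : Type*} [Fintype n] [Fintype ι]
    (H : ι → Matrix n n ℂ) (hH : ∀ l, (H l).IsHermitian)
    (hcard : Fintype.card ι < Fintype.card n ^ 2) :
    ∃ Γ : Matrix n n ℂ, Γ.IsHermitian ∧ Γ ≠ 0 ∧ ∀ l, (H l * Γ).trace = 0 := by
  let f : Matrix n n ℝ →ₗ[ℝ] (ι → ℝ) := LinearMap.pi fun l =>
    Complex.reLm ∘ₗ traceLinearMap n ℝ ℂ ∘ₗ LinearMap.mulLeft ℝ (H l) ∘ₗ hermitianOfReal n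
  have hf : f.ker ≠ ⊥ := f.ker_ne_bot_of_finrank_lt <| by
    simpa [Module.finrank_matrix, sq] using hcard
  obtain ⟨A, hA, hA0⟩ := (Submodule.ne_bot_iff _).mp hf
  refine ⟨hermitianOfReal n A, isHermitian_hermitianOfReal A,
    (map_ne_zero_iff _ (hermitianOfReal_injective n)).mpr hA0, fun l => ?_⟩
  exact Complex.ext (congrFun (LinearMap.mem_ker.mp hA) l)
    ((hH l).im_trace_mul_eq_zero (isHermitian_hermitianOfReal A))

/-- A nonzero Hermitian matrix can be scaled so that subtracting it from the identity gives a
singular positive semidefinite matrix. -/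
lemma Matrix.IsHermitian.exists_posSemidef_one_sub_smul {n : Type*} [Fintype n] [DecidableEq n]
    {Γ : Matrix n n ℂ} (hΓ : Γ.IsHermitian) (h0 : Γ ≠ 0) :
    ∃ t : ℂ, (1 - t • Γ).PosSemidef ∧ (1 - t • Γ).rank < Fintype.card n := by
  have hne : hΓ.eigenvalues ≠ 0 := mt hΓ.eigenvalues_eq_zero_iff.mp h0
  obtain ⟨k, hk⟩ := Function.ne_iff.mp hne
  obtain ⟨i, -, hi⟩ := Finset.exists_max_image Finset.univ (fun j => |hΓ.eigenvalues j|)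
    ⟨k, Finset.mem_univ k⟩
  have hi0 : 0 < |hΓ.eigenvalues i| := (abs_pos.mpr hk).trans_le (hi k (Finset.mem_univ k))
  let U : Matrix n n ℂ := hΓ.eigenvectorUnitary
  let d : n → ℂ := fun j => ((1 - (hΓ.eigenvalues i)⁻¹ * hΓ.eigenvalues j : ℝ) : ℂ)
  have hspec : Γ = U * diagonal (fun j => (hΓ.eigenvalues j : ℂ)) * Uᴴ := by
    conv_lhs => rw [hΓ.spectral_theorem, Unitary.conjStarAlgAut_apply]
    rfl
  have hU : U * Uᴴ = 1 := Unitary.mul_star_self_of_mem hΓ.eigenvectorUnitary.2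
  have hd : 1 - ((hΓ.eigenvalues i)⁻¹ : ℂ) • Γ = U * diagonal d * Uᴴ := by
    have hdiag : diagonal d = 1 - ((hΓ.eigenvalues i)⁻¹ : ℂ) •
        diagonal (fun j => (hΓ.eigenvalues j : ℂ)) := by
      rw [← diagonal_one, ← diagonal_smul, diagonal_sub]
      congr 1
      ext j
      simp [d]
    rw [hdiag, mul_sub, sub_mul, mul_one, hU, mul_smul_comm, smul_mul_assoc, ← hspec]
  refine ⟨((hΓ.eigenvalues i)⁻¹ : ℂ), ?_, ?_⟩
  · rw [hd]
    refine (PosSemidef.diagonal fun j => ?_).mul_mul_conjTranspose_same U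
    refine Complex.zero_le_real.mpr (sub_nonneg.mpr ((le_abs_self _).trans ?_))
    rw [abs_mul, abs_inv, inv_mul_le_iff₀ hi0, mul_one]
    exact hi j (Finset.mem_univ j)
  · rw [hd]
    refine ((rank_mul_le_left _ _).trans (rank_mul_le_right _ _)).trans_lt ?_
    rw [rank_diagonal]
    exact Fintype.card_subtype_lt (x := i) (by simp [d, abs_pos.mp hi0])

/-- One-step rank reduction: if `V ⪰ 0` has rank `R` with `R² > L`, there is a PSD `V̂`
of rank at most `R - 1` satisfying the same `L` trace constraints. -/
theorem exists_psd_rank_reduction (N L : ℕ) (hN : 0 < N) (hL : 0 < L)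
    (V : Matrix (Fin N) (Fin N) ℂ) (hV : V.PosSemidef)
    (R : ℕ) (hR : V.rank = R) (hRL : L < R ^ 2)
    (G : Fin L → Matrix (Fin N) (Fin N) ℂ) (hG : ∀ l, (G l).IsHermitian) :
    ∃ Vhat : Matrix (Fin N) (Fin N) ℂ, Vhat.PosSemidef ∧ Vhat.rank ≤ R - 1 ∧
      ∀ l, (G l * Vhat).trace = (G l * V).trace := by
  obtain ⟨X, hX⟩ := hV.exists_eq_mul_conjTranspose_card_eq_rank
  obtain ⟨Γ, hΓ, hΓ0, htr⟩ := exists_isHermitian_ne_zero_trace_mul_eq_zero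
    (fun l => Xᴴ * G l * X) (fun l => isHermitian_conjTranspose_mul_mul X (hG l))
    (by simpa [hR] using hRL)
  obtain ⟨t, hpsd, hrank⟩ := hΓ.exists_posSemidef_one_sub_smul hΓ0
  refine ⟨X * (1 - t • Γ) * Xᴴ, hpsd.mul_mul_conjTranspose_same X, ?_, fun l => ?_⟩
  · have h := (rank_mul_le_left (X * (1 - t • Γ)) Xᴴ).trans (rank_mul_le_right _ _)
    have hcard := Fintype.card_fin V.rank
    omega
  · have hzero : (G l * (X * Γ * Xᴴ)).trace = 0 := by
      rw [← htr l, ← Matrix.mul_assoc, trace_mul_comm]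
      simp only [Matrix.mul_assoc]
    conv_rhs => rw [hX]
    rw [Matrix.mul_sub, Matrix.sub_mul, Matrix.mul_one, Matrix.mul_smul, Matrix.smul_mul,
      Matrix.mul_sub, Matrix.mul_smul, trace_sub, trace_smul, hzero, smul_zero, sub_zero]
end

section
/- Let N, L be positive integers, let V be a positive semidefinite N×N complex matrix, and let G₁, …, G_L be Hermitian N×N complex matrices. Then there exists a positive semidefinite N×N complex matrix V̂ with Tr(G_l V̂) = Tr(G_l V) for every l = 1, …, L, with rank(V̂) ≤ rank(V), and with rank(V̂)² ≤ L, i.e. rank(V̂) ≤ √L. -/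
open Matrix
open scoped ComplexOrder

namespace Matrix

/-- The spectral theorem with the unitary conjugation written as a product of matrices. -/
lemma IsHermitian.exists_unitary_eq_mul_diagonal_mul_star {n : Type*} [Fintype n] [DecidableEq n]
    {A : Matrix n n ℂ} (hA : A.IsHermitian) :
    ∃ U : Matrix n n ℂ, U * Uᴴ = 1 ∧
      A = U * diagonal (fun i => (hA.eigenvalues i : ℂ)) * Uᴴ := by
  refine ⟨hA.eigenvectorUnitary, Unitary.coe_mul_star_self hA.eigenvectorUnitary, ?_⟩
  conv_lhs => rw [hA.spectral_theorem]
  rfl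

/-- A positive semidefinite matrix factors through a space of dimension its rank. -/
lemma PosSemidef.exists_eq_mul_conjTranspose {n : Type*} [Fintype n]
    {A : Matrix n n ℂ} (hA : A.PosSemidef) :
    ∃ W : Matrix n (Fin A.rank) ℂ, A = W * Wᴴ := by
  classical
  obtain ⟨U, -, hU⟩ := hA.1.exists_unitary_eq_mul_diagonal_mul_star
  set d := hA.1.eigenvalues
  have hcard : Fintype.card {i // d i ≠ 0} = A.rank := hA.1.rank_eq_card_non_zero_eigs.symm
  let e := Fintype.equivFinOfCardEq hcard
  refine ⟨of fun i k => U i (e.symm k) * (Real.sqrt (d (e.symm k)) : ℂ), ?_⟩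
  ext i j
  have hterm (k : n) : U i k * (Real.sqrt (d k) : ℂ) * star (U j k * (Real.sqrt (d k) : ℂ)) =
      U i k * d k * star (U j k) := by
    have hs : (Real.sqrt (d k) : ℂ) * (Real.sqrt (d k) : ℂ) = d k := by
      exact_mod_cast Real.mul_self_sqrt (hA.eigenvalues_nonneg k)
    simp only [star_mul', RCLike.star_def, Complex.conj_ofReal]
    linear_combination U i k * (starRingEnd ℂ) (U j k) * hs
  conv_lhs => rw [hU]
  rw [mul_apply, mul_apply]
  simp only [mul_diagonal, conjTranspose_apply, of_apply, hterm]
  rw [e.symm.sum_comp (fun k : {i // d i ≠ 0} => U i k * d k * star (U j k)),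
    ← Fintype.sum_subtype_add_sum_subtype (fun k => d k ≠ 0)
      (fun k => U i k * d k * star (U j k)), add_eq_left]
  refine Finset.sum_eq_zero fun k _ => ?_
  simp [not_not.mp k.2]

/-- If `A` is a nonzero Hermitian matrix, then `1 + t • A` is positive semidefinite and singular
for some real `t`. -/
lemma IsHermitian.exists_posSemidef_one_add_smul_rank_lt {n : Type*} [Fintype n] [DecidableEq n]
    {A : Matrix n n ℂ} (hA : A.IsHermitian) (h0 : A ≠ 0) :
    ∃ t : ℝ, (1 + (t : ℂ) • A).PosSemidef ∧ (1 + (t : ℂ) • A).rank < Fintype.card n := by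
  obtain ⟨U, hUU, hU⟩ := hA.exists_unitary_eq_mul_diagonal_mul_star
  have hne : hA.eigenvalues ≠ 0 := fun h => h0 (hA.eigenvalues_eq_zero_iff.mp h)
  set d := hA.eigenvalues
  obtain ⟨j, hj⟩ := Function.ne_iff.mp hne
  have : Nonempty n := ⟨j⟩
  obtain ⟨i, hi⟩ := Finite.exists_max fun k => |d k|
  have hpos : 0 < |d i| := (abs_pos.mpr hj).trans_le (hi j)
  have hdi : d i ≠ 0 := abs_pos.mp hpos
  have hfac : 1 + ((-(d i)⁻¹ : ℝ) : ℂ) • A =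
      U * diagonal (fun k => ((1 - d k / d i : ℝ) : ℂ)) * Uᴴ := by
    have hdiag : diagonal (fun k => ((1 - d k / d i : ℝ) : ℂ)) =
        1 + ((-(d i)⁻¹ : ℝ) : ℂ) • diagonal (fun k => (d k : ℂ)) := by
      rw [← diagonal_one, ← diagonal_smul, diagonal_add]
      congr 1
      ext k
      simp only [Pi.smul_apply, smul_eq_mul]
      push_cast
      ring
    rw [hdiag, mul_add, add_mul, mul_one, hUU, mul_smul_comm, smul_mul_assoc, ← hU]
  refine ⟨-(d i)⁻¹, ?_, ?_⟩
  · rw [hfac]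
    refine PosSemidef.mul_mul_conjTranspose_same (PosSemidef.diagonal fun k => ?_) U
    have hle : d k / d i ≤ 1 := by
      refine (le_abs_self _).trans ?_
      rw [abs_div]
      exact div_le_one_of_le₀ (hi k) hpos.le
    simpa using Complex.zero_le_real.mpr (sub_nonneg.mpr hle)
  · rw [hfac]
    refine ((rank_mul_le_left _ _).trans (rank_mul_le_right _ _)).trans_lt ?_
    rw [rank_diagonal]
    exact Fintype.card_subtype_lt (x := i) (by simp [div_self hdi])

/-- The real-linear map `M ↦ (M + Mᵀ) + i (M - Mᵀ)`, parametrizing Hermitian matrices by real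
ones. -/
def hermitianOfReal (n : Type*) : Matrix n n ℝ →ₗ[ℝ] Matrix n n ℂ where
  toFun M := of fun i j => ⟨M i j + M j i, M i j - M j i⟩
  map_add' M M' := by
    ext i j
    apply Complex.ext <;> simp <;> ring
  map_smul' c M := by
    ext i j
    apply Complex.ext <;> simp <;> ring

lemma isHermitian_hermitianOfReal {n : Type*} (M : Matrix n n ℝ) :
    (hermitianOfReal n M).IsHermitian := by
  ext i j
  apply Complex.ext <;> simp [hermitianOfReal, add_comm]

lemma hermitianOfReal_injective (n : Type*) : Function.Injective (hermitianOfReal n) := by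
  intro M M' h
  ext i j
  have hij := congrFun (congrFun h i) j
  have hre := congrArg Complex.re hij
  have him := congrArg Complex.im hij
  simp only [hermitianOfReal, LinearMap.coe_mk, AddHom.coe_mk, of_apply] at hre him
  linarith

lemma IsHermitian.im_trace_mul_eq_zero_s6 {n : Type*} [Fintype n] {A B : Matrix n n ℂ}
    (hA : A.IsHermitian) (hB : B.IsHermitian) : (A * B).trace.im = 0 := by
  rw [← Complex.conj_eq_iff_im, ← RCLike.star_def, ← trace_conjTranspose, conjTranspose_mul,
    hA.eq, hB.eq, trace_mul_comm]

/-- Fewer than `(card m) ^ 2` homogeneous trace constraints with Hermitian coefficients have a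
nonzero Hermitian solution. -/
lemma exists_isHermitian_ne_zero_trace_mul_eq_zero {m κ : Type*} [Fintype m] [Fintype κ]
    (G : κ → Matrix m m ℂ) (hG : ∀ l, (G l).IsHermitian)
    (hcard : Fintype.card κ < Fintype.card m ^ 2) :
    ∃ A : Matrix m m ℂ, A.IsHermitian ∧ A ≠ 0 ∧ ∀ l, (G l * A).trace = 0 := by
  classical
  let f : Matrix m m ℝ →ₗ[ℝ] κ → ℝ := LinearMap.pi fun l =>
    Complex.reLm ∘ₗ traceLinearMap m ℝ ℂ ∘ₗ LinearMap.mulLeft ℝ (G l) ∘ₗ hermitianOfReal m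
  have hker : LinearMap.ker f ≠ ⊥ := LinearMap.ker_ne_bot_of_finrank_lt <| by
    simpa [Module.finrank_matrix, sq] using hcard
  obtain ⟨M, hM, hM0⟩ := (Submodule.ne_bot_iff _).mp hker
  refine ⟨hermitianOfReal m M, isHermitian_hermitianOfReal M,
    (map_ne_zero_iff _ (hermitianOfReal_injective m)).mpr hM0, fun l => Complex.ext ?_ ?_⟩
  · exact congrFun (LinearMap.mem_ker.mp hM) l
  · exact (hG l).im_trace_mul_eq_zero_s6 (isHermitian_hermitianOfReal M)

/-- One-step rank reduction preserving trace constraints. -/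
lemma PosSemidef.exists_rank_lt_trace_mul_eq {n κ : Type*} [Fintype n] [Fintype κ]
    {V : Matrix n n ℂ} (hV : V.PosSemidef) (G : κ → Matrix n n ℂ) (hG : ∀ l, (G l).IsHermitian)
    (hcard : Fintype.card κ < V.rank ^ 2) :
    ∃ V' : Matrix n n ℂ, V'.PosSemidef ∧ (∀ l, (G l * V').trace = (G l * V).trace) ∧
      V'.rank < V.rank := by
  obtain ⟨W, hW⟩ := hV.exists_eq_mul_conjTranspose
  obtain ⟨A, hA, hA0, hGA⟩ := exists_isHermitian_ne_zero_trace_mul_eq_zero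
    (fun l => Wᴴ * G l * W) (fun l => isHermitian_conjTranspose_mul_mul W (hG l))
    (by simpa using hcard)
  obtain ⟨t, ht, hrank⟩ := hA.exists_posSemidef_one_add_smul_rank_lt hA0
  refine ⟨W * (1 + (t : ℂ) • A) * Wᴴ, ht.mul_mul_conjTranspose_same W, fun l => ?_, ?_⟩
  · have hzero : (G l * (W * A * Wᴴ)).trace = 0 := by
      rw [← hGA l, trace_mul_comm, Matrix.mul_assoc (W * A), trace_mul_comm, ← Matrix.mul_assoc]
    rw [Matrix.mul_add, Matrix.add_mul, Matrix.mul_one, ← hW, Matrix.mul_smul, Matrix.smul_mul,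
      Matrix.mul_add, trace_add, Matrix.mul_smul, trace_smul, hzero, smul_zero, add_zero]
  · refine ((rank_mul_le_left _ _).trans (rank_mul_le_right _ _)).trans_lt ?_
    simpa using hrank

/-- Trace constraints of a positive semidefinite matrix are met by one of small rank. -/
lemma PosSemidef.exists_rank_sq_le_trace_mul_eq {n κ : Type*} [Fintype n] [Fintype κ]
    {V : Matrix n n ℂ} (hV : V.PosSemidef) (G : κ → Matrix n n ℂ)
    (hG : ∀ l, (G l).IsHermitian) :
    ∃ V' : Matrix n n ℂ, V'.PosSemidef ∧ (∀ l, (G l * V').trace = (G l * V).trace) ∧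
      V'.rank ≤ V.rank ∧ V'.rank ^ 2 ≤ Fintype.card κ := by
  induction hr : V.rank using Nat.strong_induction_on generalizing V with
  | _ r ih =>
    subst hr
    by_cases hle : V.rank ^ 2 ≤ Fintype.card κ
    · exact ⟨V, hV, fun _ => rfl, le_rfl, hle⟩
    · obtain ⟨V₁, hV₁, htr₁, hlt⟩ := hV.exists_rank_lt_trace_mul_eq G hG (not_le.mp hle)
      obtain ⟨V₂, hV₂, htr₂, hle₂, hsq⟩ := ih _ hlt hV₁ rfl
      exact ⟨V₂, hV₂, fun l => (htr₂ l).trans (htr₁ l), hle₂.trans hlt.le, hsq⟩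

end Matrix

/-- There always exists a PSD matrix `V̂` meeting the same `L` trace constraints as `V`,
with `rank V̂ ≤ rank V` and `(rank V̂)² ≤ L` (i.e. `rank V̂ ≤ √L`). -/
theorem exists_psd_low_rank_same_traces (N L : ℕ) (hN : 0 < N) (hL : 0 < L)
    (V : Matrix (Fin N) (Fin N) ℂ) (hV : V.PosSemidef)
    (G : Fin L → Matrix (Fin N) (Fin N) ℂ) (hG : ∀ l, (G l).IsHermitian) :
    ∃ Vhat : Matrix (Fin N) (Fin N) ℂ, Vhat.PosSemidef ∧
      (∀ l, (G l * Vhat).trace = (G l * V).trace) ∧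
      Vhat.rank ≤ V.rank ∧ Vhat.rank ^ 2 ≤ L := by
  simpa using hV.exists_rank_sq_le_trace_mul_eq G hG
end

section
/- Let L be a positive integer, let ψ > 0 be real, let P be a positive semidefinite L×L complex matrix, let h ∈ ℂ^L, let c ∈ ℝ, and set Ω = ψ·I + P − c·(h h^H). Assume Ω is positive semidefinite and let V be a nonzero positive semidefinite L×L complex matrix with Ω·V = 0. Then rank(Ω) = L − 1 and rank(V) = 1. -/
open Matrix
open scoped ComplexOrder

namespace Matrix

theorem rank_add_le_add_rank {K m n : Type*} [Field K] [Fintype m] [Fintype n]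
    (A B : Matrix m n K) : (A + B).rank ≤ A.rank + B.rank := by
  rw [rank, rank, rank, mulVecLin_add]
  exact (Submodule.finrank_mono (LinearMap.range_add_le _ _)).trans
    (Submodule.finrank_add_le_finrank_add_finrank _ _)

theorem rank_pos_of_ne_zero {K m n : Type*} [Field K] [Fintype m] [Fintype n]
    {A : Matrix m n K} (hA : A ≠ 0) : 0 < A.rank := by
  classical
  rw [Nat.pos_iff_ne_zero, rank, Ne, Submodule.finrank_eq_zero, LinearMap.range_eq_bot]
  intro h0
  refine hA (Matrix.ext_of_mulVec_single fun i => ?_)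
  rw [← mulVecLin_apply, h0, LinearMap.zero_apply, zero_mulVec]

end Matrix

/-- If `Ω = ψ I + P − c h hᴴ ⪰ 0` with `ψ > 0`, `P ⪰ 0`, and `Ω V = 0` for a nonzero PSD `V`,
then `rank Ω = L − 1` and `rank V = 1`. -/
theorem rank_of_kkt_solution (L : ℕ) (hL : 0 < L) (ψ : ℝ) (hψ : 0 < ψ)
    (P : Matrix (Fin L) (Fin L) ℂ) (hP : P.PosSemidef)
    (h : Fin L → ℂ) (c : ℝ)
    (Ω : Matrix (Fin L) (Fin L) ℂ)
    (hΩdef : Ω = (ψ : ℂ) • (1 : Matrix (Fin L) (Fin L) ℂ) + P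
        - (c : ℂ) • Matrix.vecMulVec h (star h))
    (hΩ : Ω.PosSemidef)
    (V : Matrix (Fin L) (Fin L) ℂ) (hV : V.PosSemidef) (hVne : V ≠ 0)
    (hΩV : Ω * V = 0) :
    Ω.rank = L - 1 ∧ V.rank = 1 := by
  have hY : ((ψ : ℂ) • (1 : Matrix (Fin L) (Fin L) ℂ) + P).PosDef :=
    (PosDef.one.smul (by exact_mod_cast hψ : (0 : ℂ) < ψ)).add_posSemidef hP
  have hYrank := rank_of_isUnit _ hY.isUnit
  have hYeq : (ψ : ℂ) • (1 : Matrix (Fin L) (Fin L) ℂ) + P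
      = Ω + vecMulVec ((c : ℂ) • h) (star h) := by
    rw [hΩdef, smul_vecMulVec, sub_add_cancel]
  rw [hYeq, Fintype.card_fin] at hYrank
  have hadd := rank_add_le_add_rank Ω (vecMulVec ((c : ℂ) • h) (star h))
  have hone := rank_vecMulVec_le ((c : ℂ) • h) (star h)
  have hsum := rank_add_rank_le_card_of_mul_eq_zero hΩV
  rw [Fintype.card_fin] at hsum
  have hpos := rank_pos_of_ne_zero hVne
  omega
end
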